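/- arXiv:1606.00804 — 2 statements merged into one kernel-verified Lean document; each statement's English description precedes it below -/
import Mathlib

section
/- Let A = {1,…,k} with k ≥ 3, let m ≥ 1, and let F be any reversible gate over A with m(F) = m. Then CONS_{k−1,1} together with F generates CC_m, i.e. CC_m ∈ ⟨CONS_{k−1,1} ∪ {F}⟩, where CC_m = 1-τ_{1^m, k^m}. -/
/-- A reversible gate function of arity `n` over alphabet `A`: a bijection `A^n → A^n`. -/
abbrev GateFun (A : Type*) (n : ℕ) := (Fin n → A) ≃ (Fin n → A)

/-- A reversible gate over alphabet `A`: an arity together with a bijection of that arity. -/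
abbrev Gate (A : Type*) := Σ n : ℕ, GateFun A n

/-- The canonical identification `A^{n+m} ≃ A^n × A^m`. -/
def splitEquiv (A : Type*) (n m : ℕ) :
    (Fin (n + m) → A) ≃ ((Fin n → A) × (Fin m → A)) :=
  (Equiv.arrowCongr finSumFinEquiv.symm (Equiv.refl A)).trans
    (Equiv.sumArrowEquivProdArrow _ _ A)

/-- The permutation gate `P_σ`, mapping `(a_1,…,a_n)` to `(a_{σ(1)},…,a_{σ(n)})`. -/
def permGate (A : Type*) {n : ℕ} (σ : Equiv.Perm (Fin n)) : GateFun A n :=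
  Equiv.arrowCongr σ.symm (Equiv.refl A)

/-- Tensor product of gates. -/
def tensorGate {A : Type*} {n m : ℕ} (F : GateFun A n) (G : GateFun A m) :
    GateFun A (n + m) :=
  ((splitEquiv A n m).trans (F.prodCongr G)).trans (splitEquiv A n m).symm

/-- The generation relation: `Generates S g` means `g` can be generated from the set `S`
of reversible gates using the permutation, tensor product, composition and ancilla rules. -/
inductive Generates {A : Type*} (S : Set (Gate A)) : Gate A → Prop
  | mem {g : Gate A} : g ∈ S → Generates S g
  | perm (n : ℕ) (σ : Equiv.Perm (Fin n)) : Generates S ⟨n, permGate A σ⟩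
  | tensor {n m : ℕ} {F : GateFun A n} {G : GateFun A m} :
      Generates S ⟨n, F⟩ → Generates S ⟨m, G⟩ → Generates S ⟨n + m, tensorGate F G⟩
  | comp {n : ℕ} {F G : GateFun A n} :
      Generates S ⟨n, F⟩ → Generates S ⟨n, G⟩ → Generates S ⟨n, G.trans F⟩
  | ancilla {l m : ℕ} {F : GateFun A (l + m)} (a : Fin l → A) {F' : GateFun A m} :
      Generates S ⟨l + m, F⟩ →
      (∀ b : Fin m → A,
        F ((splitEquiv A l m).symm (a, b)) = (splitEquiv A l m).symm (a, F' b)) →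
      Generates S ⟨m, F'⟩

/-- The gate class `⟨S⟩` generated by a set `S` of reversible gates. -/
def genClosure {A : Type*} (S : Set (Gate A)) : Set (Gate A) := {g | Generates S g}

/-- A reversible gate class: a set of gates closed under the generation rules. -/
def IsGateClass {A : Type*} (S : Set (Gate A)) : Prop := ∀ g, Generates S g → g ∈ S

/-- The transposition gate `τ_{u,v}` exchanging the inputs `u` and `v`. -/
def tau {A : Type*} [DecidableEq A] {n : ℕ} (u v : Fin n → A) : GateFun A n :=
  Equiv.swap u v

/-- The controlled gate `w-F`, mapping `w u` to `w F(u)` and fixing all other inputs. -/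
def controlled {A : Type*} [DecidableEq A] {l n : ℕ} (w : Fin l → A) (F : GateFun A n) :
    GateFun A (l + n) :=
  ((splitEquiv A l n).trans
    (Equiv.prodCongrRight fun p => if p = w then F else Equiv.refl _)).trans
    (splitEquiv A l n).symm

/-- `SWAP_{a,b}` for single symbols `a`, `b`: exchanges `ab` and `ba`. -/
def swapGate {A : Type*} [DecidableEq A] (a b : A) : GateFun A 2 :=
  tau ![a, b] ![b, a]

/-- Number of occurrences of the symbol `a` in the string `x`. -/
def countOf {A : Type*} [DecidableEq A] {n : ℕ} (a : A) (x : Fin n → A) : ℕ :=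
  (Finset.univ.filter fun i => x i = a).card

/-- `c_k(x)`: the number of occurrences of the symbol `k` (the top element `⟨k-1,_⟩`
of `Fin k`) in the string `x`. -/
def countLast {k n : ℕ} (x : Fin n → Fin k) : ℕ :=
  (Finset.univ.filter fun i => (x i : ℕ) = k - 1).card

/-- A gate is mod-`m`-preserving if it preserves the number of `k` symbols mod `m`
(for `m = 0` this means preserving it exactly). -/
def ModPreserving {k : ℕ} (m : ℕ) (g : Gate (Fin k)) : Prop :=
  ∀ w, countLast (g.2 w) ≡ countLast w [MOD m]

/-- `IsModIndex g M` states that `M = m(g)`: the gate `g` is mod-`M`-preserving and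
every `m` for which `g` is mod-`m`-preserving divides `M`. (Equivalently, `M` is the
largest modulus preserved by `g`, with `M = 0` when no largest one exists.) -/
def IsModIndex {k : ℕ} (g : Gate (Fin k)) (M : ℕ) : Prop :=
  ModPreserving M g ∧ ∀ m, ModPreserving m g → m ∣ M

/-- `CONS_{k-1,1}`: the class of reversible gates preserving the number of occurrences
of the symbol `k`. -/
def CONSk1 (k : ℕ) : Set (Gate (Fin k)) :=
  {g | ∀ w, countLast (g.2 w) = countLast w}

/-- The gate `CC_m = 1-τ_{1^m, k^m}`. -/
def CC (k m : ℕ) (hk : 0 < k) : Gate (Fin k) :=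
  ⟨1 + m, controlled ![(⟨0, hk⟩ : Fin k)]
    (tau (fun _ : Fin m => (⟨0, hk⟩ : Fin k)) (fun _ => ⟨k - 1, by omega⟩))⟩

theorem splitEquiv_symm_apply {A : Type*} {n m : ℕ} (a : Fin n → A) (b : Fin m → A) :
    (splitEquiv A n m).symm (a, b) = Fin.append a b := by
  ext i
  refine Fin.addCases (fun i => ?_) (fun i => ?_) i <;>
    simp [splitEquiv, Equiv.sumArrowEquivProdArrow, Equiv.arrowCongr]

theorem countLast_splitEquiv_symm {k n m : ℕ} (a : Fin n → Fin k) (b : Fin m → Fin k) :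
    countLast ((splitEquiv (Fin k) n m).symm (a, b)) = countLast a + countLast b := by
  simp only [countLast, splitEquiv_symm_apply, Finset.card_filter, Fin.sum_univ_add,
    Fin.append_left, Fin.append_right]

theorem tensorGate_apply {A : Type*} {n m : ℕ} (F : GateFun A n) (G : GateFun A m)
    (a : Fin n → A) (b : Fin m → A) :
    tensorGate F G ((splitEquiv A n m).symm (a, b)) = (splitEquiv A n m).symm (F a, G b) := by
  simp [tensorGate]

theorem tau_splitEquiv_symm_apply {A : Type*} [DecidableEq A] {l n : ℕ} (w : Fin l → A)
    (u v b : Fin n → A) :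
    tau ((splitEquiv A l n).symm (w, u)) ((splitEquiv A l n).symm (w, v))
      ((splitEquiv A l n).symm (w, b)) = (splitEquiv A l n).symm (w, tau u v b) := by
  have h : Function.Injective fun x : Fin n → A => (splitEquiv A l n).symm (w, x) :=
    fun x y hxy => by simpa using hxy
  exact h.swap_apply u v b

theorem controlled_tau {A : Type*} [DecidableEq A] {l n : ℕ} (w : Fin l → A)
    (u v : Fin n → A) :
    controlled w (tau u v) =
      tau ((splitEquiv A l n).symm (w, u)) ((splitEquiv A l n).symm (w, v)) := by
  ext1 x
  obtain ⟨⟨p, b⟩, rfl⟩ := (splitEquiv A l n).symm.surjective x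
  by_cases hp : p = w
  · subst hp
    rw [tau_splitEquiv_symm_apply]
    simp [controlled]
  · have h : tau ((splitEquiv A l n).symm (w, u)) ((splitEquiv A l n).symm (w, v))
        ((splitEquiv A l n).symm (p, b)) = (splitEquiv A l n).symm (p, b) := by
      apply Equiv.swap_apply_of_ne_of_ne <;> simp [hp]
    rw [h]
    simp [controlled, hp]

theorem exists_countLast_eq {k l j : ℕ} (hk : 2 ≤ k) (hj : j ≤ l) :
    ∃ w : Fin l → Fin k, countLast w = j := by
  refine ⟨fun i => if (i : ℕ) < j then ⟨k - 1, by omega⟩ else ⟨0, by omega⟩, ?_⟩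
  have h : ∀ i : Fin l,
      (((if (i : ℕ) < j then ⟨k - 1, by omega⟩ else ⟨0, by omega⟩ : Fin k) : ℕ) = k - 1) ↔
        (i : ℕ) < j := by
    intro i
    split_ifs with h
    · simp [h]
    · simp only [h, iff_false]
      omega
  simp only [countLast, h]
  rw [Fin.card_filter_val_lt]
  omega

theorem Generates.one {A : Type*} (S : Set (Gate A)) (n : ℕ) :
    Generates S ⟨n, (1 : Equiv.Perm (Fin n → A))⟩ :=
  Generates.perm n 1

theorem Generates.pow {A : Type*} {S : Set (Gate A)} {n : ℕ} {F : Equiv.Perm (Fin n → A)}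
    (hF : Generates S ⟨n, F⟩) (j : ℕ) : Generates S ⟨n, F ^ j⟩ := by
  induction j with
  | zero => exact Generates.one S n
  | succ j ih => exact pow_succ F j ▸ Generates.comp ih hF

theorem Generates.inv {A : Type*} [Finite A] {S : Set (Gate A)} {n : ℕ}
    {F : Equiv.Perm (Fin n → A)} (hF : Generates S ⟨n, F⟩) : Generates S ⟨n, F⁻¹⟩ := by
  obtain ⟨j, hj⟩ := (mem_powers_iff_mem_zpowers (x := F)).2
    (Subgroup.inv_mem _ (Subgroup.mem_zpowers F))
  have hj' : F ^ j = F⁻¹ := hj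
  exact hj' ▸ hF.pow j

theorem Generates.tau_conj {A : Type*} [Finite A] [DecidableEq A] {S : Set (Gate A)} {n : ℕ}
    {F : Equiv.Perm (Fin n → A)} (hF : Generates S ⟨n, F⟩) {x y : Fin n → A}
    (h : Generates S ⟨n, tau x y⟩) : Generates S ⟨n, tau (F x) (F y)⟩ := by
  have h' : tau (F x) (F y) = F * (tau x y * F⁻¹) := by
    rw [← mul_assoc]
    exact Equiv.swap_apply_apply F x y
  rw [h']
  exact Generates.comp hF (Generates.comp h hF.inv)

theorem tau_mem_CONSk1 {k n : ℕ} {x y : Fin n → Fin k} (h : countLast x = countLast y) :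
    (⟨n, tau x y⟩ : Gate (Fin k)) ∈ CONSk1 k := by
  intro w
  simp only [tau, Equiv.swap_apply_def]
  split_ifs with h₁ h₂ <;> simp [*]

theorem Generates.tau_replace_right {k n : ℕ} {S : Set (Gate (Fin k))} (hS : CONSk1 k ⊆ S)
    {p q q' : Fin n → Fin k} (h : Generates S ⟨n, tau p q⟩) (hq : countLast q = countLast q')
    (hpq : countLast p ≠ countLast q) : Generates S ⟨n, tau p q'⟩ := by
  have hC : Generates S ⟨n, tau q q'⟩ := .mem (hS (tau_mem_CONSk1 hq))
  have h₁ : tau q q' p = p := Equiv.swap_apply_of_ne_of_ne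
    (fun e => hpq (e ▸ rfl)) (fun e => hpq (e ▸ hq.symm))
  have h₂ : tau q q' q = q' := Equiv.swap_apply_left _ _
  simpa only [h₁, h₂] using hC.tau_conj h

/-- The subgroup of differences `c_k(g x) - c_k(g y)`, over all gates `g` generated by `S` and
all inputs `x`, `y` with equally many occurrences of `k`. -/
def countShift {k : ℕ} (S : Set (Gate (Fin k))) : AddSubgroup ℤ where
  carrier := {t | ∃ (N : ℕ) (g : GateFun (Fin k) N) (x y : Fin N → Fin k),
    Generates S ⟨N, g⟩ ∧ countLast x = countLast y ∧
      (countLast (g x) : ℤ) - countLast (g y) = t}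
  zero_mem' := ⟨0, 1, Fin.elim0, Fin.elim0, Generates.one S 0, rfl, sub_self _⟩
  neg_mem' := by
    rintro t ⟨N, g, x, y, hg, hxy, ht⟩
    exact ⟨N, g, y, x, hg, hxy.symm, by omega⟩
  add_mem' := by
    rintro s t ⟨N, g, x, y, hg, hxy, hs⟩ ⟨N', g', x', y', hg', hxy', ht⟩
    refine ⟨N + N', tensorGate g g', (splitEquiv _ _ _).symm (x, x'),
      (splitEquiv _ _ _).symm (y, y'), hg.tensor hg', ?_, ?_⟩
    · simp only [countLast_splitEquiv_symm, hxy, hxy']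
    · simp only [tensorGate_apply, countLast_splitEquiv_symm]
      omega

theorem sub_mem_countShift {k n : ℕ} {S : Set (Gate (Fin k))} {F : GateFun (Fin k) n}
    (hF : Generates S ⟨n, F⟩) (w w' : Fin n → Fin k) :
    ((countLast (F w) : ℤ) - countLast w) - (countLast (F w') - countLast w') ∈
      countShift S := by
  refine ⟨n + n, tensorGate F (1 : Equiv.Perm (Fin n → Fin k)), (splitEquiv _ _ _).symm (w, w'),
    (splitEquiv _ _ _).symm (w', w), hF.tensor (Generates.one S n), ?_, ?_⟩
  · simp only [countLast_splitEquiv_symm, add_comm]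
  · simp only [tensorGate_apply, countLast_splitEquiv_symm, Equiv.Perm.one_apply]
    omega

theorem sum_pow_countLast {k : ℕ} (hk : 0 < k) (n : ℕ) (z : ℂ) :
    ∑ w : Fin n → Fin k, z ^ countLast w = ((k : ℂ) - 1 + z) ^ n := by
  have h₁ : ∀ w : Fin n → Fin k,
      z ^ countLast w = ∏ i, if (w i : ℕ) = k - 1 then z else 1 := by
    intro w
    rw [Finset.prod_ite, Finset.prod_const, Finset.prod_const_one, mul_one, countLast]
  have h₂ : ∑ a : Fin k, (if (a : ℕ) = k - 1 then z else 1) = (k : ℂ) - 1 + z := by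
    obtain ⟨k, rfl⟩ := Nat.exists_eq_succ_of_ne_zero hk.ne'
    rw [Fin.sum_univ_castSucc]
    have : ∀ i : Fin k, (i : ℕ) ≠ k := fun i => i.isLt.ne
    simp [this]
  rw [← h₂, Fintype.sum_pow]
  exact Finset.sum_congr rfl fun w _ => h₁ w

/-- Over an alphabet with at least three symbols, a bijection that shifts the number of
occurrences of `k` by a constant modulo `d` preserves that number modulo `d`. -/
theorem dvd_of_countLast_shift {k n d r : ℕ} (hk : 3 ≤ k) (F : GateFun (Fin k) n)
    (h : ∀ w, countLast (F w) ≡ countLast w + r [MOD d]) : d ∣ r := by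
  rcases Nat.eq_zero_or_pos d with rfl | hd
  · have hw := h fun _ => ⟨k - 1, by omega⟩
    rw [Nat.modEq_zero_iff] at hw
    have h₁ : countLast (F fun _ => ⟨k - 1, by omega⟩) ≤ n :=
      (Finset.card_filter_le _ _).trans (by simp)
    have h₂ : countLast (fun _ : Fin n => (⟨k - 1, by omega⟩ : Fin k)) = n := by
      simp [countLast]
    have : r = 0 := by omega
    simp [this]
  · obtain ⟨z, hz⟩ : ∃ z : ℂ, IsPrimitiveRoot z d :=
      ⟨_, Complex.isPrimitiveRoot_exp d hd.ne'⟩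
    have hpow : ∀ a b : ℕ, a ≡ b [MOD d] → z ^ a = z ^ b := fun a b hab =>
      pow_eq_pow_of_modEq hab hz.pow_eq_one
    have hsum : ((k : ℂ) - 1 + z) ^ n = ((k : ℂ) - 1 + z) ^ n * z ^ r := by
      rw [← sum_pow_countLast (by omega), Finset.sum_mul]
      conv_lhs => rw [← Equiv.sum_comp F]
      exact Finset.sum_congr rfl fun w _ => by rw [hpow _ _ (h w), pow_add]
    have hne : (k : ℂ) - 1 + z ≠ 0 := by
      intro h0
      have hz1 : ‖z‖ = 1 := hz.norm'_eq_one hd.ne'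
      have hzk : z = -((k - 1 : ℝ) : ℂ) := by
        push_cast
        linear_combination h0
      have hk' : (3 : ℝ) ≤ k := by exact_mod_cast hk
      rw [hzk, norm_neg, Complex.norm_real, Real.norm_eq_abs, abs_of_nonneg (by linarith)] at hz1
      linarith
    have hr : z ^ r = 1 := by
      have := mul_left_cancel₀ (pow_ne_zero n hne) ((mul_one _).trans hsum)
      exact this.symm
    exact hz.dvd_of_pow_eq_one r hr

theorem mem_countShift_of_isModIndex {k m n : ℕ} (hk : 3 ≤ k) {S : Set (Gate (Fin k))}
    {F : GateFun (Fin k) n} (hS : Generates S ⟨n, F⟩)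
    (hF : IsModIndex (⟨n, F⟩ : Gate (Fin k)) m) : (m : ℤ) ∈ countShift S := by
  obtain ⟨a, ha⟩ := Int.subgroup_cyclic (countShift S)
  have hmem : ∀ t : ℤ, t ∈ countShift S ↔ (a.natAbs : ℤ) ∣ t := by
    intro t
    rw [ha, AddSubgroup.mem_closure_singleton, Int.natAbs_dvd, dvd_def]
    simp only [smul_eq_mul, mul_comm, eq_comm]
  obtain ⟨w₀, hw₀⟩ := exists_countLast_eq (k := k) (by omega) (Nat.zero_le n)
  have hshift : ∀ w, countLast (F w) ≡ countLast w + countLast (F w₀) [MOD a.natAbs] := by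
    intro w
    have := (hmem _).1 (sub_mem_countShift hS w₀ w)
    rw [← Int.natCast_modEq_iff, Int.modEq_iff_dvd]
    convert this using 1
    push_cast
    rw [hw₀]
    push_cast
    ring
  have hr := dvd_of_countLast_shift hk F hshift
  rw [hmem, Int.natCast_dvd_natCast]
  refine hF.2 _ fun w => (hshift w).trans ?_
  simpa using ((Nat.modEq_zero_iff_dvd.2 hr).add_left (countLast w))

/-- Over `A = {1,…,k}` with `k ≥ 3` and `m ≥ 1`: `CONS_{k-1,1}` together with any
reversible gate `F` with `m(F) = m` generates `CC_m = 1-τ_{1^m,k^m}`. -/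
theorem consk1_with_gate_generates_cc (k m : ℕ) (hk : 3 ≤ k) (hm : 1 ≤ m)
    {n : ℕ} (F : GateFun (Fin k) n)
    (hF : IsModIndex (⟨n, F⟩ : Gate (Fin k)) m) :
    CC k m (by omega) ∈ genClosure (CONSk1 k ∪ {(⟨n, F⟩ : Gate (Fin k))}) := by
  set S := CONSk1 k ∪ {(⟨n, F⟩ : Gate (Fin k))}
  have hcons : CONSk1 k ⊆ S := Set.subset_union_left
  obtain ⟨N₀, g₀, x₀, y₀, hg₀, hxy₀, hm₀⟩ :=
    mem_countShift_of_isModIndex hk (.mem (Or.inr rfl) : Generates S ⟨n, F⟩) hF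
  obtain ⟨N, p, q, hpq, hcount, hN⟩ : ∃ (N : ℕ) (p q : Fin N → Fin k),
      Generates S ⟨N, tau p q⟩ ∧ countLast p = countLast q + m ∧
        countLast q + (1 + m) ≤ N := by
    obtain ⟨z, hz⟩ := exists_countLast_eq (k := k) (l := 1) (by omega) (Nat.zero_le 1)
    have hxy : countLast ((splitEquiv (Fin k) N₀ 1).symm (x₀, z)) =
        countLast ((splitEquiv (Fin k) N₀ 1).symm (y₀, z)) := by
      simp only [countLast_splitEquiv_symm, hxy₀]
    have hle : countLast (g₀ x₀) ≤ N₀ := (Finset.card_filter_le _ _).trans (by simp)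
    refine ⟨N₀ + 1, _, _, (hg₀.tensor (Generates.one S 1)).tau_conj
      (.mem (hcons (tau_mem_CONSk1 hxy))), ?_, ?_⟩ <;>
    · simp only [tensorGate_apply, countLast_splitEquiv_symm, Equiv.Perm.one_apply, hz]
      omega
  obtain ⟨l, rfl⟩ := Nat.exists_eq_add_of_le' (le_of_add_le_right hN)
  obtain ⟨a, ha⟩ := exists_countLast_eq (k := k) (l := l) (by omega) (by omega : countLast q ≤ l)
  have hk₀ : 0 ≠ k - 1 := by omega
  have hbot : countLast ((splitEquiv (Fin k) 1 m).symm
      (![⟨0, by omega⟩], fun _ => ⟨0, by omega⟩)) = 0 := by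
    rw [countLast_splitEquiv_symm]
    simp [countLast, hk₀]
  have htop : countLast ((splitEquiv (Fin k) 1 m).symm
      (![⟨0, by omega⟩], fun _ => ⟨k - 1, by omega⟩)) = m := by
    rw [countLast_splitEquiv_symm]
    simp [countLast, hk₀]
  have h₁ := hpq.tau_replace_right hcons
    (q' := (splitEquiv (Fin k) l (1 + m)).symm (a, (splitEquiv (Fin k) 1 m).symm
      (![⟨0, by omega⟩], fun _ => ⟨0, by omega⟩)))
    (by rw [countLast_splitEquiv_symm, hbot, ha, add_zero]) (by omega)
  rw [tau, Equiv.swap_comm] at h₁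
  have h₂ := Generates.tau_replace_right hcons h₁
    (q' := (splitEquiv (Fin k) l (1 + m)).symm (a, (splitEquiv (Fin k) 1 m).symm
      (![⟨0, by omega⟩], fun _ => ⟨k - 1, by omega⟩)))
    (by rw [countLast_splitEquiv_symm, htop, ha, hcount])
    (by rw [countLast_splitEquiv_symm, hbot]; omega)
  rw [genClosure, Set.mem_ofPred_eq, CC, controlled_tau, tau, Equiv.swap_comm]
  rw [tau, Equiv.swap_comm] at h₂
  exact h₂.ancilla a fun b => tau_splitEquiv_symm_apply a _ _ b
end

section
/- Let A = {1,…,k} with k ≥ 3. The lattice of reversible gate classes over A containing CONS_{k−1,1}, ordered by inclusion, is anti-isomorphic to the divisibility lattice (ℕ, |) of non-negative integers (where n ≤ m in the lattice order iff n | m). Explicitly, the gate class corresponding to 0 is CONS_{k−1,1} itself, and for each m ≥ 1 the gate class corresponding to m is ⟨CONS_{k−1,1} ∪ {CC_m}⟩ where CC_m = 1-τ_{1^m, k^m}; every gate class containing CONS_{k−1,1} equals exactly one of these, and ⟨CONS_{k−1,1} ∪ {CC_m}⟩ ⊆ ⟨CONS_{k−1,1} ∪ {CC_n}⟩ if and only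 if n | m. -/
/-- The gate class corresponding to `m ∈ ℕ`: `CONS_{k-1,1}` for `m = 0`, and
`⟨CONS_{k-1,1}, CC_m⟩` for `m ≥ 1`. -/
def DC (k : ℕ) (hk : 0 < k) (m : ℕ) : Set (Gate (Fin k)) :=
  if m = 0 then CONSk1 k else genClosure (CONSk1 k ∪ {CC k m hk})

open Equiv

/-- The gates that preserve the number of occurrences of the symbol `k` modulo `m`. -/
def modClass (k m : ℕ) : Set (Gate (Fin k)) :=
  {g | ∀ w, countLast (g.2 w) ≡ countLast w [MOD m]}

theorem modClass_zero (k : ℕ) : modClass k 0 = CONSk1 k := by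
  ext g
  simp only [modClass, CONSk1, Set.mem_ofPred_eq, Nat.modEq_zero_iff]

theorem CONSk1_subset_modClass (k m : ℕ) : CONSk1 k ⊆ modClass k m :=
  fun _ hg w => congrArg (· % m) (hg w)

theorem modClass_subset_of_dvd {k m n : ℕ} (h : n ∣ m) : modClass k m ⊆ modClass k n :=
  fun _ hg w => (hg w).of_dvd h

section Strings

variable {A : Type*} {n m : ℕ}

theorem splitEquiv_symm_eq_append (u : Fin n → A) (v : Fin m → A) :
    (splitEquiv A n m).symm (u, v) = Fin.append u v := by
  funext i
  refine Fin.addCases (fun i => ?_) (fun i => ?_) i <;>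
    simp [splitEquiv, Equiv.arrowCongr, Equiv.sumArrowEquivProdArrow]

theorem splitEquiv_append (u : Fin n → A) (v : Fin m → A) :
    splitEquiv A n m (Fin.append u v) = (u, v) := by
  rw [← splitEquiv_symm_eq_append, Equiv.apply_symm_apply]

theorem exists_eq_append (w : Fin (n + m) → A) :
    ∃ (u : Fin n → A) (v : Fin m → A), w = Fin.append u v :=
  ⟨_, _, (Fin.append_castAdd_natAdd (f := w)).symm⟩

theorem tensorGate_append (F : GateFun A n) (G : GateFun A m) (u : Fin n → A) (v : Fin m → A) :
    tensorGate F G (Fin.append u v) = Fin.append (F u) (G v) := by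
  simp [tensorGate, splitEquiv_append, splitEquiv_symm_eq_append]

theorem controlled_append [DecidableEq A] (w : Fin n → A) (F : GateFun A m)
    (u : Fin n → A) (v : Fin m → A) :
    controlled w F (Fin.append u v) = Fin.append u (if u = w then F v else v) := by
  simp only [controlled, Equiv.trans_apply, splitEquiv_append, Equiv.prodCongrRight_apply,
    splitEquiv_symm_eq_append]
  split_ifs <;> rfl

theorem permGate_apply (σ : Perm (Fin n)) (w : Fin n → A) : permGate A σ w = w ∘ σ := rfl

theorem append_right_injective (u : Fin n → A) :
    Function.Injective (Fin.append u : (Fin m → A) → Fin (n + m) → A) := fun x y h => by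
  have := congrArg (splitEquiv A n m) h
  simpa [splitEquiv_append] using this

end Strings

section Count

variable {k n m : ℕ}

theorem countLast_eq_sum (x : Fin n → Fin k) :
    countLast x = ∑ i, if (x i : ℕ) = k - 1 then 1 else 0 := by
  simp [countLast]

theorem countLast_append (u : Fin n → Fin k) (v : Fin m → Fin k) :
    countLast (Fin.append u v) = countLast u + countLast v := by
  simp only [countLast_eq_sum, Fin.sum_univ_add, Fin.append_left, Fin.append_right]

theorem countLast_comp_perm (σ : Perm (Fin n)) (w : Fin n → Fin k) :
    countLast (w ∘ σ) = countLast w := by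
  simp only [countLast_eq_sum, Function.comp_apply]
  exact Equiv.sum_comp σ fun i => if (w i : ℕ) = k - 1 then 1 else 0

/-- A string other than `k^n` has a companion with the same number of symbols `k`. -/
theorem exists_ne_countLast_eq (hk : 3 ≤ k) (u : Fin n → Fin k) {i : Fin n}
    (hi : (u i : ℕ) ≠ k - 1) : ∃ u', u' ≠ u ∧ countLast u' = countLast u := by
  obtain ⟨y, hy, hy'⟩ : ∃ y : Fin k, y ≠ u i ∧ (y : ℕ) ≠ k - 1 := by
    by_cases h : (u i : ℕ) = 0
    · exact ⟨⟨1, by omega⟩, fun e => by rw [← e] at h; simp at h, by simp; omega⟩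
    · exact ⟨⟨0, by omega⟩, fun e => by rw [← e] at h; simp at h, by simp; omega⟩
  refine ⟨Function.update u i y, fun e => hy (by simpa using congrFun e i), ?_⟩
  unfold countLast
  congr 1
  ext j
  by_cases hj : j = i
  · subst hj
    simp [hi, hy']
  · simp [hj]

end Count

section ModClass

variable {k : ℕ}

theorem isGateClass_modClass (k m : ℕ) : IsGateClass (modClass k m) := by
  intro g hg
  induction hg with
  | mem h => exact h
  | perm n σ =>
    intro w
    simp only [permGate_apply, countLast_comp_perm]
    exact Nat.ModEq.refl _
  | tensor _ _ hF hG =>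
    intro w
    obtain ⟨u, v, rfl⟩ := exists_eq_append w
    simp only [tensorGate_append, countLast_append]
    exact (hF u).add (hG v)
  | comp _ _ hF hG => exact fun w => (hF _).trans (hG w)
  | ancilla a _ h hF =>
    intro b
    have := hF (Fin.append a b)
    simp only [splitEquiv_symm_eq_append] at h
    simp only [h, countLast_append] at this
    exact Nat.ModEq.add_left_cancel' _ this

theorem isGateClass_genClosure {A : Type*} (S : Set (Gate A)) : IsGateClass (genClosure S) := by
  intro g hg
  induction hg with
  | mem h => exact h
  | perm n σ => exact .perm n σ
  | tensor _ _ hF hG => exact .tensor hF hG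
  | comp _ _ hF hG => exact .comp hF hG
  | ancilla a _ h hF => exact .ancilla a hF h

theorem genClosure_subset {A : Type*} {S T : Set (Gate A)} (hT : IsGateClass T) (h : S ⊆ T) :
    genClosure S ⊆ T := by
  intro g hg
  apply hT
  induction hg with
  | mem h' => exact .mem (h h')
  | perm n σ => exact .perm n σ
  | tensor _ _ hF hG => exact .tensor hF hG
  | comp _ _ hF hG => exact .comp hF hG
  | ancilla a _ h hF => exact .ancilla a hF h

theorem CC_append (m : ℕ) (hk : 0 < k) (u : Fin 1 → Fin k) (v : Fin m → Fin k) :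
    (CC k m hk).2 (Fin.append u v) = Fin.append u
      (if u = ![⟨0, hk⟩] then swap (fun _ => ⟨0, hk⟩) (fun _ => ⟨k - 1, by omega⟩) v else v) :=
  controlled_append _ _ _ _

theorem CC_mem_modClass_iff (hk : 3 ≤ k) (hk0 : 0 < k) (m n : ℕ) :
    CC k m hk0 ∈ modClass k n ↔ n ∣ m := by
  have h1 : countLast (fun _ : Fin m => (⟨0, hk0⟩ : Fin k)) = 0 := by
    simp [countLast, show ¬ (0 = k - 1) by omega]
  have h2 : countLast (fun _ : Fin m => (⟨k - 1, by omega⟩ : Fin k)) = m := by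
    simp [countLast]
  constructor
  · intro h
    have := h (Fin.append ![⟨0, hk0⟩] fun _ => ⟨0, hk0⟩)
    rw [CC_append, if_pos rfl, Equiv.swap_apply_left] at this
    erw [countLast_append, countLast_append] at this
    rw [h1, h2] at this
    exact (Nat.modEq_zero_iff_dvd).1 (Nat.ModEq.add_left_cancel' _ this)
  · intro h w
    obtain ⟨u, v, rfl⟩ := exists_eq_append w
    rw [CC_append]
    erw [countLast_append, countLast_append]
    refine Nat.ModEq.add_left _ ?_
    split_ifs
    · rw [Equiv.swap_apply_def]
      split_ifs with h3 h4
      · rw [h3, h1, h2]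
        exact (Nat.modEq_zero_iff_dvd).2 h
      · rw [h4, h1, h2]
        exact ((Nat.modEq_zero_iff_dvd).2 h).symm
      · rfl
    · rfl

theorem modClass_subset_iff (hk : 3 ≤ k) {m n : ℕ} : modClass k m ⊆ modClass k n ↔ n ∣ m :=
  ⟨fun h =>
    have hk0 : 0 < k := Nat.zero_lt_of_lt hk
    (CC_mem_modClass_iff hk hk0 m n).1 (h ((CC_mem_modClass_iff hk hk0 m m).2 dvd_rfl)),
    modClass_subset_of_dvd⟩

theorem modClass_injective (hk : 3 ≤ k) : Function.Injective (modClass k) := fun _ _ h =>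
  Nat.dvd_antisymm ((modClass_subset_iff hk).1 h.ge) ((modClass_subset_iff hk).1 h.le)

/-- No gate shifts the number of symbols `k` by a nonzero constant modulo `m`. -/
theorem dvd_of_const_shift (hk : 3 ≤ k) {n : ℕ} (F : GateFun (Fin k) n) (m : ℕ) (t : ℤ)
    (h : ∀ w, (m : ℤ) ∣ countLast (F w) - countLast w - t) : (m : ℤ) ∣ t := by
  rcases Nat.eq_zero_or_pos m with rfl | hm
  · have h1 := h fun _ => ⟨0, by omega⟩
    have h2 := h (F.symm fun _ => ⟨0, by omega⟩)
    have h3 : countLast (fun _ : Fin n => (⟨0, by omega⟩ : Fin k)) = 0 := by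
      simp [countLast, show ¬ (0 = k - 1) by omega]
    simp only [Nat.cast_zero, zero_dvd_iff, Equiv.apply_symm_apply, h3] at h1 h2 ⊢
    omega
  · set ζ : ℂ := Complex.exp (2 * Real.pi * Complex.I / m)
    have hζ : IsPrimitiveRoot ζ m := Complex.isPrimitiveRoot_exp m hm.ne'
    have hζ0 : ζ ≠ 0 := Complex.exp_ne_zero _
    have hnorm : ‖ζ‖ = 1 := hζ.norm'_eq_one hm.ne'
    have hsum : ∑ w : Fin n → Fin k, ζ ^ countLast w ≠ 0 := by
      have key : ∑ w : Fin n → Fin k, ζ ^ countLast w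
          = (∑ a : Fin k, if (a : ℕ) = k - 1 then ζ else 1) ^ n := by
        rw [Fintype.sum_pow]
        refine Finset.sum_congr rfl fun w _ => ?_
        rw [countLast_eq_sum, ← Finset.prod_pow_eq_pow_sum]
        refine Finset.prod_congr rfl fun i _ => ?_
        split_ifs <;> simp
      rw [key]
      refine pow_ne_zero _ fun h0 => ?_
      obtain ⟨j, rfl⟩ : ∃ j, k = j + 1 := ⟨k - 1, by omega⟩
      rw [Fin.sum_univ_castSucc] at h0
      have h1 : ∀ i : Fin j, (if ((Fin.castSucc i : Fin (j + 1)) : ℕ) = j + 1 - 1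
          then ζ else 1) = 1 := fun i => if_neg (by have := i.2; simp; omega)
      simp only [h1] at h0
      simp at h0
      have h2 : (j : ℂ) = -ζ := by linear_combination h0
      have h3 := congrArg norm h2
      rw [norm_neg, hnorm, Complex.norm_natCast] at h3
      have : j = 1 := by exact_mod_cast h3
      omega
    have hshift : ∑ w : Fin n → Fin k, ζ ^ countLast w
        = ζ ^ t * ∑ w : Fin n → Fin k, ζ ^ countLast w := by
      rw [Finset.mul_sum, ← Equiv.sum_comp F]
      refine Finset.sum_congr rfl fun w _ => ?_
      have h1 := (hζ.zpow_eq_one_iff_dvd _).2 (h w)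
      rw [zpow_sub₀ hζ0, zpow_sub₀ hζ0, div_div, div_eq_one_iff_eq
        (mul_ne_zero (zpow_ne_zero _ hζ0) (zpow_ne_zero _ hζ0)), zpow_natCast, zpow_natCast] at h1
      rw [h1, mul_comm]
    rw [← hζ.zpow_eq_one_iff_dvd]
    exact (mul_eq_right₀ hsum).1 hshift.symm

end ModClass

section Classification

variable {k : ℕ} {S : Set (Gate (Fin k))}

/-- The gates of arity `n` in a gate class, as a group of permutations of the strings. -/
def IsGateClass.arity (hS : IsGateClass S) (n : ℕ) : Subgroup (Perm (Fin n → Fin k)) :=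
  let M : Submonoid (Perm (Fin n → Fin k)) :=
    { carrier := {F | (⟨n, F⟩ : Gate (Fin k)) ∈ S}
      one_mem' := hS _ (.perm n 1)
      mul_mem' := fun hF hG => hS _ (.comp (.mem hF) (.mem hG)) }
  { M with
    inv_mem' := fun {F} hF => by
      have h : F⁻¹ = F ^ (orderOf F - 1) := by
        rw [inv_eq_iff_mul_eq_one, ← pow_succ', Nat.sub_add_cancel (orderOf_pos F),
          pow_orderOf_eq_one]
      rw [h]
      exact M.pow_mem hF _ }

theorem IsGateClass.mem_arity (hS : IsGateClass S) {n : ℕ} {F : Perm (Fin n → Fin k)} :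
    F ∈ hS.arity n ↔ (⟨n, F⟩ : Gate (Fin k)) ∈ S := Iff.rfl

theorem IsGateClass.swap_mem_of_countLast_eq (hS : IsGateClass S) (hC : CONSk1 k ⊆ S) {n : ℕ}
    {u v : Fin n → Fin k} (h : countLast u = countLast v) : swap u v ∈ hS.arity n := by
  refine hC fun w => ?_
  change countLast (swap u v w) = _
  rw [Equiv.swap_apply_def]
  split_ifs with h1 h2
  · rw [h1, h]
  · rw [h2, h]
  · rfl

theorem IsGateClass.swap_apply_mem (hS : IsGateClass S) {n : ℕ} {F : Perm (Fin n → Fin k)}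
    (hF : F ∈ hS.arity n) {u v : Fin n → Fin k} (h : swap u v ∈ hS.arity n) :
    swap (F u) (F v) ∈ hS.arity n := by
  rw [Equiv.swap_apply_apply]
  exact mul_mem (mul_mem hF h) (inv_mem hF)

theorem IsGateClass.tensor_one_mem (hS : IsGateClass S) {n : ℕ} (l : ℕ)
    {F : Perm (Fin n → Fin k)} (hF : F ∈ hS.arity n) :
    tensorGate F (1 : Perm (Fin l → Fin k)) ∈ hS.arity (n + l) :=
  hS _ (.tensor (.mem hF) (.mem (one_mem (hS.arity l))))

theorem IsGateClass.swap_append_right_mem (hS : IsGateClass S) (hC : CONSk1 k ⊆ S) (hk : 3 ≤ k)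
    {n l : ℕ} {u v : Fin n → Fin k} (h : swap u v ∈ hS.arity n) (x : Fin l → Fin k) :
    swap (Fin.append u x) (Fin.append v x) ∈ hS.arity (n + l) := by
  by_cases huv : countLast u = countLast v
  · exact hS.swap_mem_of_countLast_eq hC (by simp [countLast_append, huv])
  have of_companion : ∀ {u v u' : Fin n → Fin k}, swap u v ∈ hS.arity n →
      countLast u ≠ countLast v → u' ≠ u → countLast u' = countLast u →
      swap (Fin.append u x) (Fin.append v x) ∈ hS.arity (n + l) := by
    intro u v u' h huv hne hu'
    have h1 : swap (Fin.append u x) (Fin.append u' x) ∈ hS.arity (n + l) :=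
      hS.swap_mem_of_countLast_eq hC (by simp [countLast_append, hu'])
    have h2 := hS.swap_apply_mem (hS.tensor_one_mem l h) h1
    have hne' : u' ≠ v := fun e => huv (by rw [← hu', e])
    rw [tensorGate_append, tensorGate_append, Equiv.swap_apply_left,
      Equiv.swap_apply_of_ne_of_ne hne hne', Perm.one_apply, Equiv.swap_comm] at h2
    exact SubmonoidClass.swap_mem_trans _ h1 h2
  by_cases hu : ∃ i, (u i : ℕ) ≠ k - 1
  · obtain ⟨i, hi⟩ := hu
    obtain ⟨u', hne, hu'⟩ := exists_ne_countLast_eq hk u hi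
    exact of_companion h huv hne hu'
  · push Not at hu
    obtain ⟨i, hi⟩ : ∃ i, (v i : ℕ) ≠ k - 1 := by
      by_contra! hv
      exact huv (by simp [countLast, hu, hv])
    obtain ⟨v', hne, hv'⟩ := exists_ne_countLast_eq hk v hi
    rw [Equiv.swap_comm] at h ⊢
    exact of_companion h (Ne.symm huv) hne hv'

theorem IsGateClass.swap_mem_of_append_left (hS : IsGateClass S) {l n : ℕ} {u v : Fin n → Fin k}
    (x : Fin l → Fin k) (h : swap (Fin.append x u) (Fin.append x v) ∈ hS.arity (l + n)) :
    swap u v ∈ hS.arity n := by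
  refine hS _ (.ancilla x (.mem h) fun b => ?_)
  rw [splitEquiv_symm_eq_append, splitEquiv_symm_eq_append]
  exact (append_right_injective x).swap_apply u v b

/-- Whether a gate class contains a transposition depends only on the difference between the
numbers of symbols `k` in the exchanged strings. -/
theorem IsGateClass.swap_mem_of_countLast_sub_eq (hS : IsGateClass S) (hC : CONSk1 k ⊆ S)
    (hk : 3 ≤ k) {n n' : ℕ} {u v : Fin n → Fin k} {u' v' : Fin n' → Fin k}
    (h : swap u v ∈ hS.arity n)
    (hc : (countLast v' : ℤ) - countLast u' = countLast v - countLast u) :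
    swap u' v' ∈ hS.arity n' :=
  hS.swap_mem_of_append_left u <|
    SubmonoidClass.swap_mem_trans _ (hS.swap_append_right_mem hC hk h u') <|
      hS.swap_mem_of_countLast_eq hC (by simp only [countLast_append]; omega)

/-- The differences in the number of symbols `k` across the transpositions of a gate class. -/
def IsGateClass.shifts (hS : IsGateClass S) (hC : CONSk1 k ⊆ S) (hk : 3 ≤ k) : AddSubgroup ℤ where
  carrier := {d | ∃ (n : ℕ) (u v : Fin n → Fin k), swap u v ∈ hS.arity n ∧
    (countLast v : ℤ) - countLast u = d}
  zero_mem' := ⟨0, Fin.elim0, Fin.elim0, by rw [Equiv.swap_self]; exact one_mem (hS.arity 0),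
    sub_self _⟩
  neg_mem' := by
    rintro _ ⟨n, u, v, h, rfl⟩
    exact ⟨n, v, u, by rwa [Equiv.swap_comm], (neg_sub _ _).symm⟩
  add_mem' := by
    rintro _ _ ⟨n, u, v, h, rfl⟩ ⟨n', u', v', h', rfl⟩
    refine ⟨n + n', Fin.append u u', Fin.append v v', SubmonoidClass.swap_mem_trans _
      (hS.swap_append_right_mem hC hk h u') (hS.swap_mem_of_countLast_sub_eq hC hk h' ?_), ?_⟩ <;>
    · simp only [countLast_append]
      push_cast
      ring

theorem IsGateClass.swap_mem_iff (hS : IsGateClass S) (hC : CONSk1 k ⊆ S) (hk : 3 ≤ k) {n : ℕ}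
    {u v : Fin n → Fin k} :
    swap u v ∈ hS.arity n ↔ (countLast v : ℤ) - countLast u ∈ hS.shifts hC hk :=
  ⟨fun h => ⟨n, u, v, h, rfl⟩, fun ⟨_, _, _, h, hc⟩ =>
    hS.swap_mem_of_countLast_sub_eq hC hk h hc.symm⟩

theorem IsGateClass.exists_eq_modClass (hS : IsGateClass S) (hC : CONSk1 k ⊆ S) (hk : 3 ≤ k) :
    ∃ m, S = modClass k m := by
  obtain ⟨a, ha⟩ := Int.subgroup_cyclic (hS.shifts hC hk)
  have hmem : ∀ d, d ∈ hS.shifts hC hk ↔ (a.natAbs : ℤ) ∣ d := fun d => by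
    rw [ha, ← AddSubgroup.zmultiples_eq_closure, Int.mem_zmultiples_iff, Int.natAbs_dvd]
  refine ⟨a.natAbs, Set.Subset.antisymm ?_ ?_⟩
  · rintro ⟨n, F⟩ hF
    have hdiff : ∀ w w' : Fin n → Fin k, (a.natAbs : ℤ) ∣
        (countLast (F w) - countLast w) - (countLast (F w') - countLast w') := by
      intro w w'
      have h1 : swap (Fin.append w' w) (Fin.append w w') ∈ hS.arity (n + n) :=
        hS.swap_mem_of_countLast_eq hC (by simp only [countLast_append, add_comm])
      have h2 := hS.swap_apply_mem (hS.tensor_one_mem n (hS.mem_arity.2 hF)) h1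
      rw [hS.swap_mem_iff hC hk, hmem] at h2
      simp only [tensorGate_append, countLast_append, Perm.one_apply] at h2
      convert h2 using 1
      push_cast
      ring
    intro w
    have h := dvd_of_const_shift hk F a.natAbs _ fun w' => hdiff w' w
    exact ((Nat.modEq_iff_dvd).2 h).symm
  · rintro ⟨n, F⟩ hF
    let T : Set (Perm (Fin n → Fin k)) := {f | f.IsSwap ∧ f ∈ hS.arity n}
    have hT : ∀ w, swap w (F w) ∈ hS.arity n := fun w => by
      rw [hS.swap_mem_iff hC hk, hmem]
      exact (Nat.modEq_iff_dvd).1 (hF w).symm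
    have hle : Subgroup.closure T ≤ hS.arity n := (Subgroup.closure_le _).2 fun f hf => hf.2
    refine hS.mem_arity.1 (hle ?_)
    refine (mem_closure_isSwap fun f hf => hf.1).2 ⟨Set.toFinite _, fun w => ?_⟩
    by_cases hw : w = F w
    · rw [← hw]
      exact MulAction.mem_orbit_self w
    · exact ⟨⟨swap w (F w), Subgroup.subset_closure ⟨⟨w, F w, hw, rfl⟩, hT w⟩⟩,
        Equiv.swap_apply_left _ _⟩

theorem DC_eq_modClass (hk : 3 ≤ k) (hk0 : 0 < k) (m : ℕ) : DC k hk0 m = modClass k m := by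
  unfold DC
  split_ifs with h
  · rw [h, modClass_zero]
  · set G := genClosure (CONSk1 k ∪ {CC k m hk0})
    have hsub : CONSk1 k ∪ {CC k m hk0} ⊆ G := fun _ hg => .mem hg
    obtain ⟨n, hn⟩ := (isGateClass_genClosure _ : IsGateClass G).exists_eq_modClass
      (Set.subset_union_left.trans hsub) hk
    have hnm : n ∣ m := (CC_mem_modClass_iff hk hk0 m n).1 (hn ▸ hsub (Or.inr rfl))
    have hmn : m ∣ n := by
      rw [← modClass_subset_iff hk, ← hn]
      refine genClosure_subset (isGateClass_modClass k m)
        (Set.union_subset (CONSk1_subset_modClass k m) ?_)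
      rw [Set.singleton_subset_iff, CC_mem_modClass_iff hk hk0]
    exact hn.trans (congrArg _ (Nat.dvd_antisymm hnm hmn))

end Classification

/-- Over `A = {1,…,k}` with `k ≥ 3`: the lattice of reversible gate classes containing
`CONS_{k-1,1}` is anti-isomorphic to the divisibility lattice `(ℕ, ∣)`. Explicitly,
every gate class containing `CONS_{k-1,1}` equals `DC m` for a unique `m ∈ ℕ` (where
`DC 0 = CONS_{k-1,1}` and `DC m = ⟨CONS_{k-1,1}, CC_m⟩` for `m ≥ 1`), and
`DC m ⊆ DC n ↔ n ∣ m`. -/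
theorem classes_above_consk1 (k : ℕ) (hk : 3 ≤ k) :
    (∀ S : Set (Gate (Fin k)), IsGateClass S → CONSk1 k ⊆ S →
      ∃! m : ℕ, S = DC k (by omega) m) ∧
    (∀ m n : ℕ, DC k (by omega) m ⊆ DC k (by omega) n ↔ n ∣ m) := by
  refine ⟨fun S hS hC => ?_, fun m n => ?_⟩
  · obtain ⟨m, hm⟩ := hS.exists_eq_modClass hC hk
    refine ⟨m, hm.trans (DC_eq_modClass hk _ m).symm, fun n hn => modClass_injective hk ?_⟩
    rw [← hm, ← DC_eq_modClass hk _ n]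
    exact hn.symm
  · rw [DC_eq_modClass hk _, DC_eq_modClass hk _, modClass_subset_iff hk]
end
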